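/- Let ν be a Borel probability measure on 𝒳 with ν(B_ε(x⁰)) = 1, let p and p̂ be Borel measurable, and let A and B be Borel sets. Suppose either (positive reason, negative anchor) that d(z) = 1 for all z ∈ A and ν({z : d̂(z) = 0} ∩ B) = (1 − δ)·ν(B), or (negative reason, positive anchor) that d(z) = 0 for all z ∈ A and ν({z : d̂(z) = 1} ∩ B) = (1 − δ)·ν(B), for some δ ∈ [0,1], and that ν(B) > 0. If ν(A ∩ B) > δ, then the decision at x⁰ is somewhere contestable: there exists z ∈ B_ε(x⁰) with d̂(z) ≠ d(z). (Theorem 4.11 on Anchor explanations and reason intuitions.) -/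

import Mathlib

open MeasureTheory

/-- Under a probability measure, if `C` has conditional probability `1 - δ` given `B` and
`A ∩ B` has measure greater than `δ`, then `A` and `C` meet inside every almost sure set. -/
theorem exists_mem_inter_of_lt_measure {X : Type*} [MeasurableSpace X]
    {ν : Measure X} [IsProbabilityMeasure ν] {S A B C : Set X}
    (hS : MeasurableSet S) (hνS : ν S = 1) (hA : MeasurableSet A) (hB : MeasurableSet B)
    {δ : ℝ} (hδ : δ ∈ Set.Icc (0 : ℝ) 1)
    (hC : ν (C ∩ B) = ENNReal.ofReal (1 - δ) * ν B)
    (hAB : ENNReal.ofReal δ < ν (A ∩ B)) :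
    ∃ z ∈ S, z ∈ A ∩ C := by
  by_contra! h
  have hnull : ν Sᶜ = 0 := (prob_compl_eq_zero_iff hS).2 hνS
  have hdisj : AEDisjoint ν (A ∩ B) (C ∩ B) :=
    measure_mono_null (fun z hz hzS => h z hzS ⟨hz.1.1, hz.2.1⟩) hnull
  have hsum : ν (A ∩ B) + ν (C ∩ B) ≤ ν B := by
    rw [← measure_union₀' (hA.inter hB).nullMeasurableSet hdisj]
    exact measure_mono (Set.union_subset Set.inter_subset_right Set.inter_subset_right)
  have hsplit : ν B = ENNReal.ofReal δ * ν B + ν (C ∩ B) := by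
    rw [hC, ← add_mul, ← ENNReal.ofReal_add hδ.1 (sub_nonneg.2 hδ.2)]
    simp
  rw [hsplit] at hsum
  have hle : ν (A ∩ B) ≤ ENNReal.ofReal δ * ν B :=
    (ENNReal.add_le_add_iff_right (measure_ne_top ν _)).1 hsum
  exact hAB.not_ge (hle.trans (mul_le_of_le_one_right' prob_le_one))

/-- **Theorem 4.11**: let `ν` be a Borel probability measure with `ν (B_ε x0) = 1` and let
`A` (reason rule) and `B` (anchor with precision `1 − δ`) be Borel sets with `ν B > 0`.
If either `d = 1` on `A` and `ν ({d̂ = 0} ∩ B) = (1 − δ) ν B`, or `d = 0` on `A` and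
`ν ({d̂ = 1} ∩ B) = (1 − δ) ν B`, and `ν (A ∩ B) > δ`, then the decision at `x0` is
somewhere contestable: there is `z ∈ B_ε(x0)` with `d̂ z ≠ d z`. -/
theorem anchor_reason_conflict_somewhere_contestable
    {X : Type*} [MetricSpace X] [MeasurableSpace X] [BorelSpace X]
    (p phat : X → ℝ) (τ : ℝ) (hτ : τ ∈ Set.Icc (0 : ℝ) 1)
    (hpmeas : Measurable p) (hphatmeas : Measurable phat)
    (d dhat : X → ℕ)
    (hd : ∀ x, d x = if p x > τ then 1 else 0)
    (hdhat : ∀ x, dhat x = if phat x > τ then 1 else 0)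
    (x0 : X) (ε : ℝ)
    (ν : Measure X) [IsProbabilityMeasure ν]
    (hball : ν (Metric.ball x0 ε) = 1)
    (A B : Set X) (hA : MeasurableSet A) (hB : MeasurableSet B)
    (δ : ℝ) (hδ : δ ∈ Set.Icc (0 : ℝ) 1)
    (hcase :
      ((∀ z ∈ A, d z = 1) ∧ ν ({z | dhat z = 0} ∩ B) = ENNReal.ofReal (1 - δ) * ν B) ∨
      ((∀ z ∈ A, d z = 0) ∧ ν ({z | dhat z = 1} ∩ B) = ENNReal.ofReal (1 - δ) * ν B))
    (hBpos : 0 < ν B)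
    (hAB : ν (A ∩ B) > ENNReal.ofReal δ) :
    ∃ z ∈ Metric.ball x0 ε, dhat z ≠ d z := by
  rcases hcase with ⟨hdA, hC⟩ | ⟨hdA, hC⟩ <;>
  · obtain ⟨z, hz, hzA, hzC⟩ :=
      exists_mem_inter_of_lt_measure Metric.isOpen_ball.measurableSet hball hA hB hδ hC hAB
    refine ⟨z, hz, ?_⟩
    rw [Set.mem_ofPred_eq] at hzC
    rw [hdA z hzA, hzC]
    decide
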